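/- arXiv:2305.05728 — 2 statements merged into one kernel-verified Lean document; each statement's English description precedes it below -/
import Mathlib

section
/- The minimum in the definition of RMSD is attained: for any two configurations N = (n_1,…,n_m) and D = (d_1,…,d_m) of m points in three-dimensional Euclidean space (m ≥ 1), there exists a rigid motion G of ℝ³ (an isometry composed of a rotation and a translation) such that sqrt((1/m) · Σ_{k=1}^m ‖n_k − G(d_k)‖²) equals the infimum of this quantity over all rigid motions. -/
open scoped BigOperators

/-- A rigid motion of ℝ³: a rotation (an element of SO(3)) followed by a translation. -/
def IsRigidMotion (G : EuclideanSpace ℝ (Fin 3) → EuclideanSpace ℝ (Fin 3)) : Prop :=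
  ∃ R : Matrix (Fin 3) (Fin 3) ℝ, R ∈ Matrix.specialOrthogonalGroup (Fin 3) ℝ ∧
    ∃ t : EuclideanSpace ℝ (Fin 3),
      ∀ x, G x =
        (EuclideanSpace.equiv (Fin 3) ℝ).symm (R.mulVec (EuclideanSpace.equiv (Fin 3) ℝ x)) + t

/-- The root-mean-square deviation between two configurations of `m` points in ℝ³:
the infimum over rigid motions `G` of `sqrt ((1/m) * ∑ k, ‖N k - G (D k)‖²)`. -/
noncomputable def RMSD (m : ℕ) (N D : Fin m → EuclideanSpace ℝ (Fin 3)) : ℝ :=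
  sInf { r : ℝ | ∃ G : EuclideanSpace ℝ (Fin 3) → EuclideanSpace ℝ (Fin 3),
    IsRigidMotion G ∧ r = Real.sqrt ((1 / (m : ℝ)) * ∑ k, ‖N k - G (D k)‖ ^ 2) }

theorem isCompact_SO3 :
    IsCompact {R : Matrix (Fin 3) (Fin 3) ℝ | R ∈ Matrix.specialOrthogonalGroup (Fin 3) ℝ} := by
  have hK : IsCompact (Set.univ.pi fun _ : Fin 3 => Set.univ.pi fun _ : Fin 3 =>
      Set.Icc (-1 : ℝ) 1) :=
    isCompact_univ_pi fun _ => isCompact_univ_pi fun _ => isCompact_Icc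
  have hC : IsClosed {R : Matrix (Fin 3) (Fin 3) ℝ |
      R ∈ Matrix.specialOrthogonalGroup (Fin 3) ℝ} := by
    have h : {R : Matrix (Fin 3) (Fin 3) ℝ | R ∈ Matrix.specialOrthogonalGroup (Fin 3) ℝ}
        = {R | R * R.transpose = 1} ∩ {R | R.det = 1} := by
      ext R
      simp [Matrix.mem_specialOrthogonalGroup_iff, Matrix.mem_orthogonalGroup_iff]
    rw [h]
    exact (isClosed_eq (by fun_prop) continuous_const).inter
      (isClosed_eq (by fun_prop) continuous_const)
  refine IsCompact.of_isClosed_subset hK hC ?_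
  intro R hR i _ j _
  have := entry_norm_bound_of_unitary (𝕜 := ℝ) (U := R) hR.1 i j
  rw [Real.norm_eq_abs, abs_le] at this
  exact this

theorem sum_sub_mean_le (m : ℕ) (hm : 1 ≤ m) (v : Fin m → EuclideanSpace ℝ (Fin 3))
    (t : EuclideanSpace ℝ (Fin 3)) :
    ∑ k, ‖v k - (1 / (m : ℝ)) • ∑ j, v j‖ ^ 2 ≤ ∑ k, ‖v k - t‖ ^ 2 := by
  set μ := (1 / (m : ℝ)) • ∑ j, v j with hμ
  have hm0 : (m : ℝ) ≠ 0 := by positivity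
  have hs : ∑ k, (v k - μ) = 0 := by
    rw [Finset.sum_sub_distrib, Finset.sum_const, Finset.card_univ, Fintype.card_fin, hμ,
      ← Nat.cast_smul_eq_nsmul ℝ, smul_smul, mul_one_div_cancel hm0, one_smul, sub_self]
  have h : ∀ k, ‖v k - t‖ ^ 2
      = ‖v k - μ‖ ^ 2 + 2 * inner ℝ (v k - μ) (μ - t) + ‖μ - t‖ ^ 2 := by
    intro k
    rw [← norm_add_sq_real, sub_add_sub_cancel]
  simp_rw [h]
  rw [Finset.sum_add_distrib, Finset.sum_add_distrib, ← Finset.mul_sum, ← sum_inner, hs,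
    inner_zero_left]
  have : 0 ≤ ∑ k : Fin m, ‖μ - t‖ ^ 2 := by positivity
  linarith

/-- The minimum in the definition of RMSD is attained. -/
theorem rmsd_min_attained (m : ℕ) (hm : 1 ≤ m)
    (N D : Fin m → EuclideanSpace ℝ (Fin 3)) :
    ∃ G : EuclideanSpace ℝ (Fin 3) → EuclideanSpace ℝ (Fin 3), IsRigidMotion G ∧
      Real.sqrt ((1 / (m : ℝ)) * ∑ k, ‖N k - G (D k)‖ ^ 2) = RMSD m N D := by
  let A : Matrix (Fin 3) (Fin 3) ℝ → EuclideanSpace ℝ (Fin 3) → EuclideanSpace ℝ (Fin 3) :=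
    fun R x =>
      (EuclideanSpace.equiv (Fin 3) ℝ).symm (R.mulVec (EuclideanSpace.equiv (Fin 3) ℝ x))
  have hA : ∀ x, Continuous fun R => A R x := fun x =>
    (EuclideanSpace.equiv (Fin 3) ℝ).symm.continuous.comp
      (Continuous.matrix_mulVec continuous_id continuous_const)
  let T : Matrix (Fin 3) (Fin 3) ℝ → EuclideanSpace ℝ (Fin 3) :=
    fun R => (1 / (m : ℝ)) • ∑ j, (N j - A R (D j))
  have hf : Continuous fun R => ∑ k, ‖(N k - A R (D k)) - T R‖ ^ 2 := by
    fun_prop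
  obtain ⟨R, hR, hmin⟩ := isCompact_SO3.exists_isMinOn ⟨1, one_mem (Matrix.specialOrthogonalGroup (Fin 3) ℝ)⟩
    hf.continuousOn
  have hG : IsRigidMotion (fun x => A R x + T R) := ⟨R, hR, T R, fun x => rfl⟩
  refine ⟨fun x => A R x + T R, hG, ?_⟩
  have hl : IsLeast { r : ℝ | ∃ G : EuclideanSpace ℝ (Fin 3) → EuclideanSpace ℝ (Fin 3),
      IsRigidMotion G ∧ r = Real.sqrt ((1 / (m : ℝ)) * ∑ k, ‖N k - G (D k)‖ ^ 2) }
      (Real.sqrt ((1 / (m : ℝ)) * ∑ k, ‖N k - (A R (D k) + T R)‖ ^ 2)) := by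
    refine ⟨⟨_, hG, rfl⟩, ?_⟩
    rintro _ ⟨G, ⟨S, hS, t, hGS⟩, rfl⟩
    have hGS' : ∀ x, G x = A S x + t := hGS
    apply Real.sqrt_le_sqrt
    apply mul_le_mul_of_nonneg_left _ (by positivity)
    simp_rw [hGS', ← sub_sub]
    exact (hmin hS).trans (sum_sub_mean_le m hm (fun k => N k - A S (D k)) t)
  exact hl.csInf_eq.symm
end

section
/- RMSD satisfies the triangle inequality, so that together with symmetry and nonnegativity it defines a pseudometric on configurations: for any configurations N, D, P of m points in ℝ³ (m ≥ 1), RMSD(N, P) ≤ RMSD(N, D) + RMSD(D, P). -/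
open scoped BigOperators

theorem IsRigidMotion.comp {G H : EuclideanSpace ℝ (Fin 3) → EuclideanSpace ℝ (Fin 3)}
    (hG : IsRigidMotion G) (hH : IsRigidMotion H) : IsRigidMotion (fun x => G (H x)) := by
  obtain ⟨R, hR, t, ht⟩ := hG
  obtain ⟨S, hS, s, hs⟩ := hH
  refine ⟨R * S, mul_mem hR hS, G s, fun x => ?_⟩
  change G (H x) = _
  rw [ht (H x), ht s, hs, map_add, Matrix.mulVec_add, map_add, ContinuousLinearEquiv.apply_symm_apply,
    Matrix.mulVec_mulVec, add_assoc]

theorem IsRigidMotion.norm_sub {G : EuclideanSpace ℝ (Fin 3) → EuclideanSpace ℝ (Fin 3)}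
    (hG : IsRigidMotion G) (x y : EuclideanSpace ℝ (Fin 3)) : ‖G x - G y‖ = ‖x - y‖ := by
  obtain ⟨R, hR, t, ht⟩ := hG
  have h1 : R.transpose * R = 1 := by
    have h := (Matrix.mem_specialOrthogonalGroup_iff.1 hR).1
    exact (Matrix.mem_orthogonalGroup_iff' _ _).1 h
  have h2 : G x - G y = (EuclideanSpace.equiv (Fin 3) ℝ).symm
      (R.mulVec (EuclideanSpace.equiv (Fin 3) ℝ (x - y))) := by
    rw [ht, ht, map_sub, Matrix.mulVec_sub, map_sub]; abel
  have key : ∀ v : EuclideanSpace ℝ (Fin 3), ‖v‖ ^ 2 =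
      (EuclideanSpace.equiv (Fin 3) ℝ v) ⬝ᵥ (EuclideanSpace.equiv (Fin 3) ℝ v) := by
    intro v
    rw [EuclideanSpace.norm_sq_eq]
    simp [dotProduct, pow_two]
  have h3 : ‖G x - G y‖ ^ 2 = ‖x - y‖ ^ 2 := by
    rw [key, key (x - y), h2, ContinuousLinearEquiv.apply_symm_apply, Matrix.dotProduct_mulVec,
      ← Matrix.mulVec_transpose, Matrix.mulVec_mulVec, h1, Matrix.one_mulVec]
  exact (sq_eq_sq₀ (norm_nonneg _) (norm_nonneg _)).1 h3

theorem isRigidMotion_id : IsRigidMotion (fun x => x) :=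
  ⟨1, one_mem _, 0, fun x => by simp⟩

theorem sqrt_mink (m : ℕ) (c : ℝ) (hc : 0 ≤ c) (a b d : Fin m → ℝ) (h0 : ∀ k, 0 ≤ a k)
    (h : ∀ k, a k ≤ b k + d k) :
    Real.sqrt (c * ∑ k, a k ^ 2) ≤ Real.sqrt (c * ∑ k, b k ^ 2) + Real.sqrt (c * ∑ k, d k ^ 2) := by
  have hn : ∀ f : Fin m → ℝ, ‖(WithLp.toLp 2 f : EuclideanSpace ℝ (Fin m))‖
      = Real.sqrt (∑ k, f k ^ 2) := by
    intro f
    rw [EuclideanSpace.norm_eq]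
    simp
  rw [Real.sqrt_mul hc, Real.sqrt_mul hc, Real.sqrt_mul hc, ← mul_add]
  refine mul_le_mul_of_nonneg_left ?_ (Real.sqrt_nonneg _)
  calc Real.sqrt (∑ k, a k ^ 2) ≤ Real.sqrt (∑ k, (b + d) k ^ 2) := by
        apply Real.sqrt_le_sqrt
        exact Finset.sum_le_sum fun k _ => pow_le_pow_left₀ (h0 k) (h k) 2
    _ ≤ _ := by
        rw [← hn, ← hn, ← hn, WithLp.toLp_add]
        exact norm_add_le _ _

/-- RMSD satisfies the triangle inequality. -/
theorem rmsd_triangle (m : ℕ) (hm : 1 ≤ m)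
    (N D P : Fin m → EuclideanSpace ℝ (Fin 3)) :
    RMSD m N P ≤ RMSD m N D + RMSD m D P := by
  have hne : ∀ A B : Fin m → EuclideanSpace ℝ (Fin 3),
      { r : ℝ | ∃ G : EuclideanSpace ℝ (Fin 3) → EuclideanSpace ℝ (Fin 3),
      IsRigidMotion G ∧ r = Real.sqrt ((1 / (m : ℝ)) * ∑ k, ‖A k - G (B k)‖ ^ 2) }.Nonempty :=
    fun A B => ⟨_, _, isRigidMotion_id, rfl⟩
  have main : ∀ G H, IsRigidMotion G → IsRigidMotion H →
      RMSD m N P ≤ Real.sqrt ((1 / (m : ℝ)) * ∑ k, ‖N k - G (D k)‖ ^ 2)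
        + Real.sqrt ((1 / (m : ℝ)) * ∑ k, ‖D k - H (P k)‖ ^ 2) := by
    intro G H hG hH
    have hle : RMSD m N P ≤ Real.sqrt ((1 / (m : ℝ)) * ∑ k, ‖N k - G (H (P k))‖ ^ 2) := by
      refine csInf_le ⟨0, ?_⟩ ⟨_, hG.comp hH, rfl⟩
      rintro r ⟨_, _, rfl⟩
      exact Real.sqrt_nonneg _
    refine hle.trans ?_
    · refine sqrt_mink m _ (by positivity) _ _ _ (fun k => norm_nonneg _) fun k => ?_
      rw [← hG.norm_sub (D k)]
      exact norm_sub_le_norm_sub_add_norm_sub _ _ _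
  rw [← sub_le_iff_le_add]
  refine le_csInf (hne N D) ?_
  rintro r ⟨G, hG, rfl⟩
  rw [sub_le_comm]
  refine le_csInf (hne D P) ?_
  rintro s ⟨H, hH, rfl⟩
  have := main G H hG hH
  linarith
end
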